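/- Let K_p, K_q : ℤ → ℝ be even, absolutely summable functions whose spectra S_p(f) = Σ_{m∈ℤ} K_p(m) e^{−2πi f m} and S_q(f) = Σ_{m∈ℤ} K_q(m) e^{−2πi f m} satisfy 0 < c ≤ S_p(f), S_q(f) ≤ M for all f ∈ [0,1]. Let Λ_p^{(n)} and Λ_q^{(n)} be the n×n symmetric Toeplitz matrices with entries K_p(i−j) and K_q(i−j) (which are then positive definite and invertible). Then (1/n) · tr( Λ_p^{(n)} (Λ_q^{(n)})^{−1} ) → ∫₀¹ S_p(f)/S_q(f) df as n → ∞. -/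

import Mathlib

open MeasureTheory Filter Matrix

/-- The spectrum `S(f) = Σ_{m ∈ ℤ} K(m) e^{-2πi f m}` of an even, absolutely summable
auto-covariance function `K : ℤ → ℝ`; by evenness it equals the real cosine series. -/
noncomputable def spectrum' (K : ℤ → ℝ) (f : ℝ) : ℝ :=
  ∑' m : ℤ, K m * Real.cos (2 * Real.pi * f * (m : ℝ))

/-- The `n × n` symmetric Toeplitz matrix with entries `K(i - j)`. -/
def toeplitz (K : ℤ → ℝ) (n : ℕ) : Matrix (Fin n) (Fin n) ℝ :=
  fun i j => K ((i : ℤ) - (j : ℤ))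

lemma continuous_spectrum' {K : ℤ → ℝ} (hK : Summable fun m => |K m|) :
    Continuous (spectrum' K) := by
  unfold spectrum'
  refine continuous_tsum (fun m => by fun_prop) hK fun m f => ?_
  rw [Real.norm_eq_abs, abs_mul]
  exact mul_le_of_le_one_right (abs_nonneg _) (Real.abs_cos_le_one _)

lemma spectrum'_neg (K : ℤ → ℝ) (f : ℝ) : spectrum' K (-f) = spectrum' K f := by
  unfold spectrum'
  refine tsum_congr fun m => ?_
  rw [← Real.cos_neg]
  ring_nf

lemma cos_add_one_mul_int (f : ℝ) (m : ℤ) :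
    Real.cos (2 * Real.pi * (f + 1) * m) = Real.cos (2 * Real.pi * f * m) := by
  rw [show 2 * Real.pi * (f + 1) * m = 2 * Real.pi * f * m + m * (2 * Real.pi) by ring,
    Real.cos_add_int_mul_two_pi]

lemma spectrum'_periodic (K : ℤ → ℝ) : Function.Periodic (spectrum' K) 1 := fun f => by
  simp only [spectrum', cos_add_one_mul_int]

lemma integral_cos_int (m : ℤ) :
    ∫ f in (0 : ℝ)..1, Real.cos (2 * Real.pi * f * m) = if m = 0 then 1 else 0 := by
  split_ifs with h
  · simp [h]
  · have hm : (2 * Real.pi * m : ℝ) ≠ 0 := by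
      have := Real.pi_ne_zero
      have : (m : ℝ) ≠ 0 := by exact_mod_cast h
      positivity
    have := intervalIntegral.integral_comp_mul_left (a := 0) (b := 1) Real.cos hm
    rw [integral_cos] at this
    rw [show (fun f : ℝ => Real.cos (2 * Real.pi * f * m))
      = fun f => Real.cos (2 * Real.pi * m * f) from funext fun f => by ring_nf, this]
    have : Real.sin (2 * Real.pi * m * 1) = 0 := by
      rw [← Real.sin_int_mul_pi (2 * m)]; push_cast; ring_nf
    rw [this]; simp

lemma integral_cos_mul_cos (m l : ℤ) :
    ∫ f in (0 : ℝ)..1, Real.cos (2 * Real.pi * f * m) * Real.cos (2 * Real.pi * f * l)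
      = ((if m = l then 1 else 0) + if m = -l then 1 else 0) / 2 := by
  have h : ∀ f : ℝ, Real.cos (2 * Real.pi * f * m) * Real.cos (2 * Real.pi * f * l)
      = (Real.cos (2 * Real.pi * f * (m - l : ℤ))
        + Real.cos (2 * Real.pi * f * (m + l : ℤ))) / 2 := by
    intro f
    push_cast
    rw [mul_sub, mul_add, Real.cos_sub, Real.cos_add]
    ring
  simp_rw [h]
  rw [intervalIntegral.integral_div, intervalIntegral.integral_add, integral_cos_int,
    integral_cos_int]
  · simp only [sub_eq_zero, add_eq_zero_iff_eq_neg]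
  all_goals exact Continuous.intervalIntegrable (by fun_prop) _ _

/-- The autocovariance is recovered from its spectrum by Fourier inversion. -/
lemma integral_spectrum'_mul_cos {K : ℤ → ℝ} (hev : ∀ m, K (-m) = K m)
    (hK : Summable fun m => |K m|) (l : ℤ) :
    ∫ f in (0 : ℝ)..1, spectrum' K f * Real.cos (2 * Real.pi * f * l) = K l := by
  have hs : ∀ f, Summable fun m : ℤ => K m * Real.cos (2 * Real.pi * f * (m : ℝ)) := by
    refine fun f => Summable.of_norm_bounded hK fun m => ?_
    rw [Real.norm_eq_abs, abs_mul]
    exact mul_le_of_le_one_right (abs_nonneg _) (Real.abs_cos_le_one _)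
  have key := intervalIntegral.hasSum_integral_of_dominated_convergence (a := 0) (b := 1)
    (μ := volume)
    (F := fun m : ℤ => fun f : ℝ =>
      K m * Real.cos (2 * Real.pi * f * m) * Real.cos (2 * Real.pi * f * l))
    (f := fun f => spectrum' K f * Real.cos (2 * Real.pi * f * l))
    (fun m _ => |K m|)
    (fun m => (Continuous.aestronglyMeasurable (by fun_prop)))
    (fun m => ae_of_all _ fun f _ => by
      rw [Real.norm_eq_abs, abs_mul, abs_mul, mul_assoc]
      exact mul_le_of_le_one_right (abs_nonneg _)
        (mul_le_one₀ (Real.abs_cos_le_one _) (abs_nonneg _) (Real.abs_cos_le_one _)))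
    (ae_of_all _ fun f _ => hK) (by simp)
    (ae_of_all _ fun f _ => (hs f).hasSum.mul_right _)
  refine key.unique ?_
  have e : (fun m : ℤ => ∫ f in (0 : ℝ)..1,
      K m * Real.cos (2 * Real.pi * f * m) * Real.cos (2 * Real.pi * f * l))
      = fun m => (if m = l then K l / 2 else 0) + if m = -l then K l / 2 else 0 := by
    funext m
    simp_rw [mul_assoc (K m)]
    rw [intervalIntegral.integral_const_mul, integral_cos_mul_cos]
    have e1 : m = l → K m = K l := fun h => by rw [h]
    have e2 : m = -l → K m = K l := fun h => by rw [h, hev]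
    split_ifs with h1 h2 h2
    · rw [e1 h1]; ring
    · rw [e1 h1]; ring
    · rw [e2 h2]; ring
    · ring
  rw [e]
  have := (hasSum_ite_eq l (K l / 2)).add (hasSum_ite_eq (-l) (K l / 2))
  simpa using this

/-- The squared modulus of the trigonometric polynomial `∑ xᵢ e^{2πi sᵢ f}`. -/
lemma sq_add_sq_trig_sum {ι : Type*} [Fintype ι] (x : ι → ℝ) (s : ι → ℤ) (f : ℝ) :
    (∑ i, x i * Real.cos (2 * Real.pi * f * s i)) ^ 2
      + (∑ i, x i * Real.sin (2 * Real.pi * f * s i)) ^ 2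
      = ∑ i, ∑ j, x i * x j * Real.cos (2 * Real.pi * f * (s i - s j : ℤ)) := by
  rw [sq, sq, Finset.sum_mul_sum, Finset.sum_mul_sum, ← Finset.sum_add_distrib]
  refine Finset.sum_congr rfl fun i _ => ?_
  rw [← Finset.sum_add_distrib]
  refine Finset.sum_congr rfl fun j _ => ?_
  push_cast
  rw [mul_sub, Real.cos_sub]
  ring

lemma integral_mul_sq_trig_sum {ι : Type*} [Fintype ι] (x : ι → ℝ) (s : ι → ℤ) {g : ℝ → ℝ}
    (hg : Continuous g) :
    ∫ f in (0 : ℝ)..1, g f * ((∑ i, x i * Real.cos (2 * Real.pi * f * s i)) ^ 2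
      + (∑ i, x i * Real.sin (2 * Real.pi * f * s i)) ^ 2)
      = ∑ i, ∑ j, x i * x j *
        ∫ f in (0 : ℝ)..1, g f * Real.cos (2 * Real.pi * f * (s i - s j : ℤ)) := by
  simp_rw [sq_add_sq_trig_sum, Finset.mul_sum]
  rw [intervalIntegral.integral_finsetSum
    fun i _ => Continuous.intervalIntegrable (by fun_prop) _ _]
  refine Finset.sum_congr rfl fun i _ => ?_
  rw [intervalIntegral.integral_finsetSum
    fun i _ => Continuous.intervalIntegrable (by fun_prop) _ _]
  refine Finset.sum_congr rfl fun j _ => ?_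
  rw [← intervalIntegral.integral_const_mul]
  congr 1
  funext f
  ring

lemma integral_sq_trig_sum {ι : Type*} [Fintype ι] (x : ι → ℝ) {s : ι → ℤ}
    (hs : Function.Injective s) :
    ∫ f in (0 : ℝ)..1, ((∑ i, x i * Real.cos (2 * Real.pi * f * s i)) ^ 2
      + (∑ i, x i * Real.sin (2 * Real.pi * f * s i)) ^ 2) = ∑ i, x i ^ 2 := by
  classical
  have h := integral_mul_sq_trig_sum x s (continuous_const (y := (1 : ℝ)))
  simp only [one_mul, integral_cos_int] at h
  rw [h]
  refine Finset.sum_congr rfl fun i _ => ?_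
  simp [sub_eq_zero, hs.eq_iff, sq]

/-- A lower bound on the spectrum bounds the Toeplitz quadratic form from below. -/
lemma toeplitz_quadratic_lower_bound {K : ℤ → ℝ} (hev : ∀ m, K (-m) = K m)
    (hK : Summable fun m => |K m|) {c : ℝ} (hc : ∀ f ∈ Set.Icc (0 : ℝ) 1, c ≤ spectrum' K f)
    (n : ℕ) (x : Fin n → ℝ) :
    c * ∑ i, x i ^ 2 ≤ ∑ i, ∑ j, x i * x j * toeplitz K n i j := by
  have hS := continuous_spectrum' hK
  have hinj : Function.Injective fun i : Fin n => (i : ℤ) := fun i j h =>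
    Fin.ext (Int.ofNat_inj.1 h)
  have h := integral_mul_sq_trig_sum x (fun i : Fin n => (i : ℤ)) hS
  simp only [integral_spectrum'_mul_cos hev hK] at h
  unfold toeplitz
  rw [← h, ← integral_sq_trig_sum x hinj, ← intervalIntegral.integral_const_mul]
  refine intervalIntegral.integral_mono_on zero_le_one
    (Continuous.intervalIntegrable (by fun_prop) _ _)
    (Continuous.intervalIntegrable (by fun_prop) _ _) fun f hf => ?_
  exact mul_le_mul_of_nonneg_right (hc f hf) (by positivity)

/-- The Bessel inequality for the cosine coefficients of a function bounded by `ε`. -/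
lemma sum_sq_cos_coeff_le {ι : Type*} [Fintype ι] {s : ι → ℤ} (hs : Function.Injective s)
    {g : ℝ → ℝ} (hg : Continuous g) {ε : ℝ} (hε : ∀ f ∈ Set.Icc (0 : ℝ) 1, |g f| ≤ ε) :
    ∑ i, (∫ f in (0 : ℝ)..1, g f * Real.cos (2 * Real.pi * f * s i)) ^ 2 ≤ ε ^ 2 := by
  set d : ι → ℝ := fun i => ∫ f in (0 : ℝ)..1, g f * Real.cos (2 * Real.pi * f * s i) with hd
  have hcross : ∫ f in (0 : ℝ)..1, 2 * (g f * ∑ i, d i * Real.cos (2 * Real.pi * f * s i))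
      = 2 * ∑ i, d i ^ 2 := by
    simp_rw [Finset.mul_sum]
    rw [intervalIntegral.integral_finsetSum
      fun i _ => Continuous.intervalIntegrable (by fun_prop) _ _]
    refine Finset.sum_congr rfl fun i _ => ?_
    calc _ = ∫ f in (0 : ℝ)..1, 2 * d i * (g f * Real.cos (2 * Real.pi * f * s i)) := by
          congr 1
          funext f
          ring
      _ = 2 * d i * d i := intervalIntegral.integral_const_mul _ _
      _ = 2 * d i ^ 2 := by ring
  have hle : ∫ f in (0 : ℝ)..1, 2 * (g f * ∑ i, d i * Real.cos (2 * Real.pi * f * s i))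
      ≤ ∫ f in (0 : ℝ)..1, (ε ^ 2 + ((∑ i, d i * Real.cos (2 * Real.pi * f * s i)) ^ 2
        + (∑ i, d i * Real.sin (2 * Real.pi * f * s i)) ^ 2)) := by
    refine intervalIntegral.integral_mono_on zero_le_one
      (Continuous.intervalIntegrable (by fun_prop) _ _)
      (Continuous.intervalIntegrable (by fun_prop) _ _) fun f hf => ?_
    have h1 : g f ^ 2 ≤ ε ^ 2 := by
      rw [← sq_abs]
      exact pow_le_pow_left₀ (abs_nonneg _) (hε f hf) 2
    nlinarith [sq_nonneg (g f - ∑ i, d i * Real.cos (2 * Real.pi * f * s i)),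
      sq_nonneg (∑ i, d i * Real.sin (2 * Real.pi * f * s i))]
  rw [hcross, intervalIntegral.integral_add (Continuous.intervalIntegrable (by fun_prop) _ _)
    (Continuous.intervalIntegrable (by fun_prop) _ _), integral_sq_trig_sum d hs] at hle
  simp at hle
  linarith

/-- Continuous even `1`-periodic functions are uniform limits of cosine polynomials. -/
lemma exists_cos_polynomial_near {h : ℝ → ℝ} (hcont : Continuous h) (hper : Function.Periodic h 1)
    (heven : ∀ f, h (-f) = h f) {ε : ℝ} (hε : 0 < ε) :
    ∃ (L : ℕ) (r : ℤ → ℝ), (∀ l, r (-l) = r l) ∧ (∀ l ∉ Finset.Icc (-(L : ℤ)) L, r l = 0) ∧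
      ∀ f, |h f - ∑ l ∈ Finset.Icc (-(L : ℤ)) L, r l * Real.cos (2 * Real.pi * f * l)| ≤ ε := by
  have hlift : Continuous (hper.lift : UnitAddCircle → ℝ) :=
    continuous_quot_lift _ hcont
  let H : C(UnitAddCircle, ℂ) := ⟨fun x => ((hper.lift x : ℝ) : ℂ), by fun_prop⟩
  have hH : H ∈ (Submodule.span ℂ (Set.range (fourier (T := (1 : ℝ))))).topologicalClosure := by
    rw [span_fourier_closure_eq_top]; trivial
  obtain ⟨P, hP, hdist⟩ := Metric.mem_closure_iff.1 hH ε hε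
  obtain ⟨a, rfl⟩ := Finsupp.mem_span_range_iff_exists_finsupp.1 hP
  obtain ⟨L, hL⟩ : ∃ L : ℕ, ∀ l ∈ a.support, l.natAbs ≤ L :=
    ⟨a.support.sup Int.natAbs, fun l hl => Finset.le_sup (f := Int.natAbs) hl⟩
  have ha : ∀ l ∉ Finset.Icc (-(L : ℤ)) L, a l = 0 := by
    intro l hl
    by_contra h0
    have := hL l (Finsupp.mem_support_iff.2 h0)
    rw [Finset.mem_Icc] at hl
    omega
  have hbound : ∀ f : ℝ, |h f - ∑ l ∈ Finset.Icc (-(L : ℤ)) L,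
      ((a l).re * Real.cos (2 * Real.pi * f * l) - (a l).im * Real.sin (2 * Real.pi * f * l))|
        ≤ ε := by
    intro f
    have h1 := ContinuousMap.norm_coe_le_norm (H - a.sum fun l z => z • fourier l)
      (f : UnitAddCircle)
    rw [← dist_eq_norm] at h1
    have h2 := (Complex.abs_re_le_norm _).trans (h1.trans hdist.le)
    rw [ContinuousMap.sub_apply, Complex.sub_re,
      Finsupp.sum_of_support_subset a (s := Finset.Icc (-(L : ℤ)) L) ?_
        (fun l z => z • fourier l) (fun _ _ => by ext x; exact zero_mul _),
      ContinuousMap.sum_apply, Complex.re_sum] at h2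
    · refine le_of_eq_of_le (congrArg (fun z => |h f - z|) ?_) h2
      refine Finset.sum_congr rfl fun l _ => ?_
      rw [ContinuousMap.smul_apply, fourier_coe_apply, smul_eq_mul, Complex.mul_re,
        show 2 * (Real.pi : ℂ) * Complex.I * l * f / (1 : ℝ)
          = ((2 * Real.pi * f * l : ℝ) : ℂ) * Complex.I by push_cast; ring,
        Complex.exp_ofReal_mul_I_re, Complex.exp_ofReal_mul_I_im]
    · intro l hl
      by_contra h0
      exact Finsupp.mem_support_iff.1 hl (ha l h0)
  refine ⟨L, fun l => ((a l).re + (a (-l)).re) / 2, fun l => ?_, fun l hl => ?_, fun f => ?_⟩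
  · simp [add_comm]
  · have hl' : -l ∉ Finset.Icc (-(L : ℤ)) L := by
      rw [Finset.mem_Icc] at hl ⊢; omega
    simp [ha l hl, ha (-l) hl']
  · have h1 := hbound f
    have h2 := hbound (-f)
    rw [heven] at h2
    have hsymm : ∑ l ∈ Finset.Icc (-(L : ℤ)) L, (a (-l)).re * Real.cos (2 * Real.pi * f * l)
        = ∑ l ∈ Finset.Icc (-(L : ℤ)) L, (a l).re * Real.cos (2 * Real.pi * f * l) := by
      refine Finset.sum_nbij' (fun l => -l) (fun l => -l) ?_ ?_ ?_ ?_ ?_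
      · intro l hl; rw [Finset.mem_Icc] at hl ⊢; omega
      · intro l hl; rw [Finset.mem_Icc] at hl ⊢; omega
      · simp
      · simp
      · intro l _; simp
    simp only [mul_neg, neg_mul, Real.cos_neg, Real.sin_neg, Finset.sum_sub_distrib,
      Finset.sum_neg_distrib] at h1 h2
    have e : ∑ l ∈ Finset.Icc (-(L : ℤ)) L,
        ((a l).re + (a (-l)).re) / 2 * Real.cos (2 * Real.pi * f * l)
        = ∑ l ∈ Finset.Icc (-(L : ℤ)) L, (a l).re * Real.cos (2 * Real.pi * f * l) := by
      simp_rw [add_div, add_mul, div_mul_eq_mul_div]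
      rw [Finset.sum_add_distrib, ← Finset.sum_div, ← Finset.sum_div, hsymm]
      ring
    rw [e, abs_le]
    rw [abs_le] at h1 h2
    constructor <;> linarith [h1.1, h1.2, h2.1, h2.2]

lemma sum_fin_sub_eq_sum_Icc {n L : ℕ} {G : ℤ → ℝ}
    (hG : ∀ l ∉ Finset.Icc (-(L : ℤ)) L, G l = 0) (j : Fin n) (h1 : L ≤ (j : ℕ))
    (h2 : (j : ℕ) + L < n) :
    ∑ k : Fin n, G ((k : ℤ) - (j : ℤ)) = ∑ l ∈ Finset.Icc (-(L : ℤ)) L, G l := by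
  let e : Fin n ↪ ℤ := ⟨fun k => (k : ℤ) - (j : ℤ), fun a b hab => by
    simp only [sub_left_inj, Nat.cast_inj] at hab
    exact Fin.ext hab⟩
  have hmap : ∑ l ∈ Finset.univ.map e, G l = ∑ k : Fin n, G ((k : ℤ) - (j : ℤ)) :=
    Finset.sum_map _ _ _
  rw [← hmap]
  refine (Finset.sum_subset (fun l hl => ?_) fun l _ hl => hG l hl).symm
  rw [Finset.mem_Icc] at hl
  refine Finset.mem_map.2 ⟨⟨(l + j).toNat, by omega⟩, Finset.mem_univ _, ?_⟩
  change (((l + j).toNat : ℕ) : ℤ) - (j : ℤ) = l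
  omega

lemma toeplitz_row_sq_le {K : ℤ → ℝ} (hK : Summable fun m => |K m|) (n : ℕ) (j : Fin n) :
    ∑ k, toeplitz K n j k ^ 2 ≤ (∑' m, |K m|) ^ 2 := by
  let e : Fin n ↪ ℤ := ⟨fun k => (j : ℤ) - (k : ℤ), fun a b hab => by
    simp only [sub_right_inj, Nat.cast_inj] at hab
    exact Fin.ext hab⟩
  have hmap : ∑ l ∈ Finset.univ.map e, |K l| = ∑ k, |toeplitz K n j k| :=
    Finset.sum_map _ _ _
  calc ∑ k, toeplitz K n j k ^ 2 = ∑ k, |toeplitz K n j k| ^ 2 := by simp only [sq_abs]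
    _ ≤ (∑ k, |toeplitz K n j k|) ^ 2 :=
        Finset.sum_sq_le_sq_sum_of_nonneg fun _ _ => abs_nonneg _
    _ ≤ (∑' m, |K m|) ^ 2 := by
        rw [← hmap]
        exact pow_le_pow_left₀ (Finset.sum_nonneg fun _ _ => abs_nonneg _)
          (hK.sum_le_tsum _ fun _ _ => abs_nonneg _) 2

lemma isUnit_det_toeplitz {K : ℤ → ℝ} (hev : ∀ m, K (-m) = K m)
    (hK : Summable fun m => |K m|) {c : ℝ} (hc0 : 0 < c)
    (hc : ∀ f ∈ Set.Icc (0 : ℝ) 1, c ≤ spectrum' K f) (n : ℕ) :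
    IsUnit (toeplitz K n).det := by
  rw [isUnit_iff_ne_zero]
  intro hdet
  obtain ⟨x, hx0, hx⟩ := Matrix.exists_mulVec_eq_zero_iff.2 hdet
  have h := toeplitz_quadratic_lower_bound hev hK hc n x
  have hz : ∑ i, ∑ j, x i * x j * toeplitz K n i j = 0 := by
    refine Finset.sum_eq_zero fun i _ => ?_
    have := congrFun hx i
    simp only [Matrix.mulVec, dotProduct, Pi.zero_apply] at this
    calc _ = x i * ∑ j, toeplitz K n i j * x j := by
          rw [Finset.mul_sum]; exact Finset.sum_congr rfl fun j _ => by ring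
      _ = 0 := by rw [this, mul_zero]
  have hsum : ∑ i, x i ^ 2 = 0 :=
    le_antisymm (by nlinarith) (Finset.sum_nonneg fun _ _ => sq_nonneg _)
  refine hx0 (funext fun i => ?_)
  have := (Finset.sum_eq_zero_iff_of_nonneg fun _ _ => sq_nonneg _).1 hsum i (Finset.mem_univ _)
  simpa using this

/-- The cosine coefficients of `1 - S R`, where `R` is the even cosine polynomial with
coefficients `r`. -/
lemma integral_one_sub_spectrum'_mul_cos {K : ℤ → ℝ} (hev : ∀ m, K (-m) = K m)
    (hK : Summable fun m => |K m|) {L : ℕ} {r : ℤ → ℝ} (hr : ∀ l, r (-l) = r l) (s : ℤ) :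
    ∫ f in (0 : ℝ)..1, (1 - spectrum' K f * ∑ l ∈ Finset.Icc (-(L : ℤ)) L,
        r l * Real.cos (2 * Real.pi * f * l)) * Real.cos (2 * Real.pi * f * s)
      = (if s = 0 then 1 else 0) - ∑ l ∈ Finset.Icc (-(L : ℤ)) L, r l * K (s - l) := by
  have hS := continuous_spectrum' hK
  have hpt : ∀ f : ℝ, (1 - spectrum' K f * ∑ l ∈ Finset.Icc (-(L : ℤ)) L,
        r l * Real.cos (2 * Real.pi * f * l)) * Real.cos (2 * Real.pi * f * s)
      = Real.cos (2 * Real.pi * f * s) - ∑ l ∈ Finset.Icc (-(L : ℤ)) L,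
        r l / 2 * (spectrum' K f * Real.cos (2 * Real.pi * f * (s - l : ℤ))
          + spectrum' K f * Real.cos (2 * Real.pi * f * (s + l : ℤ))) := by
    intro f
    rw [sub_mul, one_mul, mul_assoc (spectrum' K f), Finset.sum_mul, Finset.mul_sum]
    congr 1
    refine Finset.sum_congr rfl fun l _ => ?_
    push_cast
    rw [mul_sub, mul_add (2 * Real.pi * f), Real.cos_sub, Real.cos_add]
    ring
  have hsymm : ∑ l ∈ Finset.Icc (-(L : ℤ)) L, r l * K (s + l)
      = ∑ l ∈ Finset.Icc (-(L : ℤ)) L, r l * K (s - l) := by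
    refine Finset.sum_nbij' (fun l => -l) (fun l => -l) ?_ ?_ ?_ ?_ ?_
    · intro l hl; rw [Finset.mem_Icc] at hl ⊢; omega
    · intro l hl; rw [Finset.mem_Icc] at hl ⊢; omega
    · simp
    · simp
    · intro l _; simp [hr]
  simp_rw [hpt]
  rw [intervalIntegral.integral_sub (Continuous.intervalIntegrable (by fun_prop) _ _)
    (Continuous.intervalIntegrable (by fun_prop) _ _), integral_cos_int,
    intervalIntegral.integral_finsetSum
      fun i _ => Continuous.intervalIntegrable (by fun_prop) _ _]
  congr 1
  have hterm : ∀ l : ℤ, ∫ f in (0 : ℝ)..1,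
      r l / 2 * (spectrum' K f * Real.cos (2 * Real.pi * f * (s - l : ℤ))
          + spectrum' K f * Real.cos (2 * Real.pi * f * (s + l : ℤ)))
      = (r l * K (s - l) + r l * K (s + l)) / 2 := by
    intro l
    rw [intervalIntegral.integral_const_mul,
      intervalIntegral.integral_add (Continuous.intervalIntegrable (by fun_prop) _ _)
        (Continuous.intervalIntegrable (by fun_prop) _ _),
      integral_spectrum'_mul_cos hev hK, integral_spectrum'_mul_cos hev hK]
    ring
  simp_rw [hterm]
  rw [← Finset.sum_div, Finset.sum_add_distrib, hsymm]
  ring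

section RatioMatrix

variable {Kp Kq : ℤ → ℝ} {c : ℝ} {n : ℕ}

lemma sum_toeplitz_ratio_mul (hKq_even : ∀ m, Kq (-m) = Kq m)
    (hKq_sum : Summable fun m => |Kq m|) (hc : 0 < c)
    (hSq : ∀ f ∈ Set.Icc (0 : ℝ) 1, c ≤ spectrum' Kq f) (j k : Fin n) :
    ∑ i, (toeplitz Kp n * (toeplitz Kq n)⁻¹) j i * toeplitz Kq n i k = toeplitz Kp n j k := by
  rw [← Matrix.mul_apply, Matrix.nonsing_inv_mul_cancel_right _ _
    (isUnit_det_toeplitz hKq_even hKq_sum hc hSq n)]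

lemma toeplitz_ratio_row_sq_le (hKp_sum : Summable fun m => |Kp m|)
    (hKq_even : ∀ m, Kq (-m) = Kq m)
    (hKq_sum : Summable fun m => |Kq m|) (hc : 0 < c)
    (hSq : ∀ f ∈ Set.Icc (0 : ℝ) 1, c ≤ spectrum' Kq f) (j : Fin n) :
    ∑ i, (toeplitz Kp n * (toeplitz Kq n)⁻¹) j i ^ 2 ≤ ((∑' m, |Kp m|) / c) ^ 2 := by
  set A := toeplitz Kp n * (toeplitz Kq n)⁻¹ with hA
  set N := ∑ i, A j i ^ 2 with hN
  have hN0 : 0 ≤ N := Finset.sum_nonneg fun _ _ => sq_nonneg _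
  have h1 : c * N ≤ ∑ k, toeplitz Kp n j k * A j k := by
    refine (toeplitz_quadratic_lower_bound hKq_even hKq_sum hSq n (A j)).trans_eq ?_
    rw [Finset.sum_comm]
    refine Finset.sum_congr rfl fun k _ => ?_
    rw [← sum_toeplitz_ratio_mul hKq_even hKq_sum hc hSq j k, Finset.sum_mul]
    exact Finset.sum_congr rfl fun i _ => by ring
  have h2 : (c * N) ^ 2 ≤ (∑' m, |Kp m|) ^ 2 * N :=
    (pow_le_pow_left₀ (by positivity) h1 2).trans
      ((Finset.sum_mul_sq_le_sq_mul_sq _ _ _).trans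
        (mul_le_mul_of_nonneg_right (toeplitz_row_sq_le hKp_sum n j) hN0))
  rw [div_pow, le_div_iff₀ (by positivity)]
  rcases hN0.eq_or_lt with h0 | h0
  · rw [← h0, zero_mul]; positivity
  · nlinarith

lemma abs_toeplitz_ratio_diag_le (hKp_sum : Summable fun m => |Kp m|)
    (hKq_even : ∀ m, Kq (-m) = Kq m)
    (hKq_sum : Summable fun m => |Kq m|) (hc : 0 < c)
    (hSq : ∀ f ∈ Set.Icc (0 : ℝ) 1, c ≤ spectrum' Kq f) (j : Fin n) :
    |(toeplitz Kp n * (toeplitz Kq n)⁻¹) j j| ≤ (∑' m, |Kp m|) / c := by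
  refine abs_le_of_sq_le_sq ?_ (div_nonneg (tsum_nonneg fun _ => abs_nonneg _) hc.le)
  exact (Finset.single_le_sum (f := fun i => (toeplitz Kp n * (toeplitz Kq n)⁻¹) j i ^ 2)
    (fun _ _ => sq_nonneg _) (Finset.mem_univ j)).trans
    (toeplitz_ratio_row_sq_le hKp_sum hKq_even hKq_sum hc hSq j)

/-- Away from the corners, the diagonal of `Λ_p Λ_q⁻¹` is close to `∑ r(l) K_p(l)` when
the cosine polynomial with coefficients `r` nearly inverts `S_q`. -/
lemma abs_toeplitz_ratio_diag_sub_le (hKp_even : ∀ m, Kp (-m) = Kp m)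
    (hKp_sum : Summable fun m => |Kp m|) (hKq_even : ∀ m, Kq (-m) = Kq m)
    (hKq_sum : Summable fun m => |Kq m|) (hc : 0 < c)
    (hSq : ∀ f ∈ Set.Icc (0 : ℝ) 1, c ≤ spectrum' Kq f) {L : ℕ} {r : ℤ → ℝ}
    (hr : ∀ l, r (-l) = r l) (hr0 : ∀ l ∉ Finset.Icc (-(L : ℤ)) L, r l = 0) {η : ℝ}
    (hη0 : 0 ≤ η)
    (hη : ∀ f ∈ Set.Icc (0 : ℝ) 1, |1 - spectrum' Kq f * ∑ l ∈ Finset.Icc (-(L : ℤ)) L,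
        r l * Real.cos (2 * Real.pi * f * l)| ≤ η)
    (j : Fin n) (h1 : L ≤ (j : ℕ)) (h2 : (j : ℕ) + L < n) :
    |(toeplitz Kp n * (toeplitz Kq n)⁻¹) j j - ∑ l ∈ Finset.Icc (-(L : ℤ)) L, r l * Kp l|
      ≤ (∑' m, |Kp m|) / c * η := by
  have hP : 0 ≤ ∑' m, |Kp m| := tsum_nonneg fun _ => abs_nonneg _
  have hrow := toeplitz_ratio_row_sq_le hKp_sum hKq_even hKq_sum hc hSq j
  have hmul := sum_toeplitz_ratio_mul (Kp := Kp) hKq_even hKq_sum hc hSq j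
  set A := toeplitz Kp n * (toeplitz Kq n)⁻¹ with hA
  have hSc := continuous_spectrum' hKq_sum
  have hinj : Function.Injective fun i : Fin n => (i : ℤ) - (j : ℤ) := fun a b hab => by
    simp only [sub_left_inj, Nat.cast_inj] at hab
    exact Fin.ext hab
  have hB := sum_sq_cos_coeff_le hinj (g := fun f => 1 - spectrum' Kq f *
    ∑ l ∈ Finset.Icc (-(L : ℤ)) L, r l * Real.cos (2 * Real.pi * f * l)) (by fun_prop) hη
  simp only [integral_one_sub_spectrum'_mul_cos hKq_even hKq_sum hr] at hB
  set b : Fin n → ℝ := fun i => (if (i : ℤ) - (j : ℤ) = 0 then 1 else 0)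
    - ∑ l ∈ Finset.Icc (-(L : ℤ)) L, r l * Kq ((i : ℤ) - (j : ℤ) - l) with hb
  have hb' : ∀ i, b i = (if i = j then 1 else 0)
      - ∑ k : Fin n, toeplitz Kq n i k * r ((k : ℤ) - (j : ℤ)) := by
    intro i
    have := sum_fin_sub_eq_sum_Icc (G := fun l => r l * Kq ((i : ℤ) - (j : ℤ) - l))
      (fun l hl => by simp [hr0 l hl]) j h1 h2
    simp only [hb]
    rw [← this]
    congr 1
    · simp [sub_eq_zero, Fin.ext_iff]
    · refine Finset.sum_congr rfl fun k _ => ?_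
      rw [sub_sub_sub_cancel_right, mul_comm]
      rfl
  have hdiag : A j j - ∑ l ∈ Finset.Icc (-(L : ℤ)) L, r l * Kp l = ∑ i, A j i * b i := by
    have hV := sum_fin_sub_eq_sum_Icc (G := fun l => r l * Kp l)
      (fun l hl => by simp [hr0 l hl]) j h1 h2
    simp_rw [hb', mul_sub]
    rw [Finset.sum_sub_distrib, ← hV]
    congr 1
    · simp
    · simp_rw [Finset.mul_sum]
      rw [Finset.sum_comm]
      refine Finset.sum_congr rfl fun k _ => ?_
      simp_rw [← mul_assoc]
      rw [← Finset.sum_mul, hmul k, toeplitz, ← hKp_even, neg_sub, mul_comm]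
  rw [hdiag]
  refine abs_le_of_sq_le_sq ?_ (by positivity)
  rw [mul_pow]
  exact (Finset.sum_mul_sq_le_sq_mul_sq _ _ _).trans
    (mul_le_mul hrow hB (Finset.sum_nonneg fun _ _ => sq_nonneg _) (by positivity))

end RatioMatrix

/-- A sum of terms that are at most `C`, and at most `ε` except for `L` of them at either end. -/
lemma abs_sum_fin_le_of_interior {n L : ℕ} {t : Fin n → ℝ} {ε C : ℝ} (hε : 0 ≤ ε) (hC : 0 ≤ C)
    (hall : ∀ j, |t j| ≤ C) (hinner : ∀ j : Fin n, L ≤ (j : ℕ) → (j : ℕ) + L < n → |t j| ≤ ε) :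
    |∑ j, t j| ≤ n * ε + 2 * L * C := by
  have h1 : ∀ j : Fin n, |t j| ≤ ε + ((if (j : ℕ) < L then C else 0)
      + if n ≤ (j : ℕ) + L then C else 0) := by
    intro j
    have := hall j
    split_ifs with ha hb hb
    · linarith
    · linarith
    · linarith
    · simpa using hinner j (not_lt.1 ha) (not_le.1 hb)
  have hL : ∑ j : Fin n, (if (j : ℕ) < L then C else 0) ≤ L * C := by
    rw [Fin.sum_univ_eq_sum_range (fun j => if j < L then C else 0), ← Finset.sum_filter,
      Finset.sum_const, nsmul_eq_mul]
    refine mul_le_mul_of_nonneg_right ?_ hC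
    have : ((Finset.range n).filter (· < L)) ⊆ Finset.range L := fun j hj => by
      simp only [Finset.mem_filter] at hj
      exact Finset.mem_range.2 hj.2
    simpa using Finset.card_le_card this
  have hR : ∑ j : Fin n, (if n ≤ (j : ℕ) + L then C else 0) ≤ L * C := by
    rw [Fin.sum_univ_eq_sum_range (fun j => if n ≤ j + L then C else 0), ← Finset.sum_filter,
      Finset.sum_const, nsmul_eq_mul]
    refine mul_le_mul_of_nonneg_right ?_ hC
    have : ((Finset.range n).filter (n ≤ · + L)) ⊆ Finset.Ico (n - L) n := fun j hj => by
      simp only [Finset.mem_filter, Finset.mem_range] at hj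
      rw [Finset.mem_Ico]
      omega
    have := Finset.card_le_card this
    rw [Nat.card_Ico] at this
    exact_mod_cast this.trans (by omega)
  refine (Finset.abs_sum_le_sum_abs _ _).trans ((Finset.sum_le_sum fun j _ => h1 j).trans ?_)
  rw [Finset.sum_add_distrib, Finset.sum_add_distrib]
  simp only [Finset.sum_const, Finset.card_univ, Fintype.card_fin, nsmul_eq_mul]
  linarith

/-- **Normalized trace of `Λ_p⁽ⁿ⁾ (Λ_q⁽ⁿ⁾)⁻¹`.** If the spectra `S_p`, `S_q` of even,
absolutely summable auto-covariances `K_p`, `K_q` satisfy `0 < c ≤ S_p, S_q ≤ M` on `[0,1]`,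
then `(1/n) tr(Λ_p⁽ⁿ⁾ (Λ_q⁽ⁿ⁾)⁻¹) → ∫₀¹ S_p(f)/S_q(f) df`. -/
theorem toeplitz_trace_ratio_tendsto
    (Kp Kq : ℤ → ℝ)
    (hKp_even : ∀ m, Kp (-m) = Kp m) (hKq_even : ∀ m, Kq (-m) = Kq m)
    (hKp_sum : Summable fun m : ℤ => |Kp m|) (hKq_sum : Summable fun m : ℤ => |Kq m|)
    (c M : ℝ) (hc : 0 < c) (hcM : c ≤ M)
    (hSp : ∀ f ∈ Set.Icc (0 : ℝ) 1, c ≤ spectrum' Kp f ∧ spectrum' Kp f ≤ M)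
    (hSq : ∀ f ∈ Set.Icc (0 : ℝ) 1, c ≤ spectrum' Kq f ∧ spectrum' Kq f ≤ M) :
    Tendsto (fun n : ℕ => (toeplitz Kp n * (toeplitz Kq n)⁻¹).trace / (n : ℝ))
      atTop (nhds (∫ f in (0 : ℝ)..1, spectrum' Kp f / spectrum' Kq f)) := by
  have hcq : ∀ f ∈ Set.Icc (0 : ℝ) 1, c ≤ spectrum' Kq f := fun f hf => (hSq f hf).1
  have hM : 0 < M := hc.trans_le hcM
  have hSpc := continuous_spectrum' hKp_sum
  have hSqc := continuous_spectrum' hKq_sum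
  have hq_pos : ∀ f, 0 < spectrum' Kq f := by
    intro f
    obtain ⟨y, hy, hfy⟩ := (spectrum'_periodic Kq).exists_mem_Ico₀ one_pos f
    rw [hfy]
    exact hc.trans_le (hcq y ⟨hy.1, hy.2.le⟩)
  have hinvc : Continuous fun f => (spectrum' Kq f)⁻¹ := hSqc.inv₀ fun f => (hq_pos f).ne'
  set P := (∑' m, |Kp m|) / c with hPdef
  have hP : 0 ≤ P := div_nonneg (tsum_nonneg fun _ => abs_nonneg _) hc.le
  set I := ∫ f in (0 : ℝ)..1, spectrum' Kp f / spectrum' Kq f with hI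
  rw [Metric.tendsto_atTop]
  intro ε hε
  set δ := ε / (2 * (M * (P + 1))) with hδdef
  have hδ : 0 < δ := by positivity
  obtain ⟨L, r, hr, hr0, hR⟩ := exists_cos_polynomial_near hinvc
    (fun f => by simp only [spectrum'_periodic Kq f])
    (fun f => by simp only [spectrum'_neg]) hδ
  set V := ∑ l ∈ Finset.Icc (-(L : ℤ)) L, r l * Kp l with hV
  have hη : ∀ f ∈ Set.Icc (0 : ℝ) 1, |1 - spectrum' Kq f * ∑ l ∈ Finset.Icc (-(L : ℤ)) L,
      r l * Real.cos (2 * Real.pi * f * l)| ≤ M * δ := by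
    intro f hf
    have h0 := hq_pos f
    rw [← mul_inv_cancel₀ h0.ne', ← mul_sub, abs_mul, abs_of_pos h0]
    exact mul_le_mul (hSq f hf).2 (hR f) (abs_nonneg _) hM.le
  have hVI : |V - I| ≤ M * δ := by
    have hVint : V = ∫ f in (0 : ℝ)..1, spectrum' Kp f *
        ∑ l ∈ Finset.Icc (-(L : ℤ)) L, r l * Real.cos (2 * Real.pi * f * l) := by
      simp_rw [Finset.mul_sum]
      rw [intervalIntegral.integral_finsetSum
        fun i _ => Continuous.intervalIntegrable (by fun_prop) _ _, hV]
      refine Finset.sum_congr rfl fun l _ => ?_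
      rw [← integral_spectrum'_mul_cos hKp_even hKp_sum l, ← intervalIntegral.integral_const_mul]
      congr 1
      funext f
      ring
    simp_rw [div_eq_mul_inv] at hI
    rw [hVint, hI, ← intervalIntegral.integral_sub
      (Continuous.intervalIntegrable (by fun_prop) _ _)
      (Continuous.intervalIntegrable (by fun_prop) _ _)]
    have := intervalIntegral.norm_integral_le_of_norm_le_const (a := 0) (b := 1) (C := M * δ)
      (f := fun f => spectrum' Kp f * (∑ l ∈ Finset.Icc (-(L : ℤ)) L,
        r l * Real.cos (2 * Real.pi * f * l)) - spectrum' Kp f * (spectrum' Kq f)⁻¹) ?_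
    · simpa using this
    · intro f hf
      rw [Set.uIoc_of_le zero_le_one] at hf
      have hf' := hSp f ⟨hf.1.le, hf.2⟩
      rw [← mul_sub, Real.norm_eq_abs, abs_mul, abs_sub_comm, abs_of_pos (hc.trans_le hf'.1)]
      exact mul_le_mul hf'.2 (hR f) (abs_nonneg _) hM.le
  have htrace : ∀ n : ℕ, |(toeplitz Kp n * (toeplitz Kq n)⁻¹).trace - n * V|
      ≤ n * (P * (M * δ)) + 2 * L * (P + |V|) := by
    intro n
    have := abs_sum_fin_le_of_interior (n := n) (L := L)
      (t := fun j => (toeplitz Kp n * (toeplitz Kq n)⁻¹) j j - V) (ε := P * (M * δ))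
      (C := P + |V|) (by positivity) (by positivity)
      (fun j => (abs_sub _ _).trans (add_le_add_left
        (abs_toeplitz_ratio_diag_le hKp_sum hKq_even hKq_sum hc hcq j) _))
      (abs_toeplitz_ratio_diag_sub_le hKp_even hKp_sum hKq_even hKq_sum hc hcq hr hr0
        (by positivity) hη)
    simpa [Finset.sum_sub_distrib, Matrix.trace] using this
  obtain ⟨N, hN⟩ := exists_nat_gt (2 * L * (P + |V|) / (ε / 2))
  refine ⟨N + 1, fun n hn => ?_⟩
  have hn0 : (0 : ℝ) < n := by exact_mod_cast (by omega : 0 < n)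
  have hNn : 2 * L * (P + |V|) < n * (ε / 2) := by
    rw [div_lt_iff₀ (by positivity)] at hN
    refine hN.trans_le (mul_le_mul_of_nonneg_right ?_ (by positivity))
    exact_mod_cast (by omega : N ≤ n)
  have hδε : P * (M * δ) + M * δ = ε / 2 := by
    rw [hδdef]
    field_simp
  have h1 : |(toeplitz Kp n * (toeplitz Kq n)⁻¹).trace / n - V| < P * (M * δ) + ε / 2 := by
    rw [show (toeplitz Kp n * (toeplitz Kq n)⁻¹).trace / n - V
      = ((toeplitz Kp n * (toeplitz Kq n)⁻¹).trace - n * V) / n by field_simp,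
      abs_div, abs_of_pos hn0, div_lt_iff₀ hn0]
    linarith [htrace n]
  rw [Real.dist_eq]
  linarith [abs_sub_le ((toeplitz Kp n * (toeplitz Kq n)⁻¹).trace / n) V I]
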